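/- arXiv:2510.11724 — 8 statements merged into one kernel-verified Lean document; each statement's English description precedes it below -/
import Mathlib

section
/- Let m, n, k, l, t, r be positive integers with t ≥ 2, k ≥ l ≥ t+r, and min{m,n} ≥ k+l−t+2. Let i, j ∈ [max{m,n}] with i < j. Let 𝒜 ⊆ C([n],k) and ℬ ⊆ C([m],l) be cross-t-intersecting families, and suppose there exists a (t+2r)-element subset T ⊆ [min{m,n}] such that S_{ij}(𝒜) = {A ∈ C([n],k) : |A ∩ T| ≥ t+r} and S_{ij}(ℬ) = {B ∈ C([m],l) : |B ∩ T| ≥ t+r}. Then there exists a (t+2r)-element subset T' ⊆ [min{m,n}] such that 𝒜 = {A ∈ C([n],k) : |A ∩ T'| ≥ t+r} and ℬ = {B ∈ C([m],l) : |B ∩ T'| ≥ t+r}. -/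
/-- The shift `S_{ij}` applied to a single set `A` (relative to the family `F`):
if `j ∈ A`, `i ∉ A` and `(A \ {j}) ∪ {i} ∉ F`, replace `j` by `i`; otherwise keep `A`. -/
def shiftSet (F : Finset (Finset ℕ)) (i j : ℕ) (A : Finset ℕ) : Finset ℕ :=
  if j ∈ A ∧ i ∉ A ∧ insert i (A.erase j) ∉ F then insert i (A.erase j) else A

/-- The shifted family `S_{ij}(F) = {S_{ij}(A) : A ∈ F}`. -/
def shiftFam (i j : ℕ) (F : Finset (Finset ℕ)) : Finset (Finset ℕ) :=
  F.image (shiftSet F i j)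

section Shift

variable {i j : ℕ} {F : Finset (Finset ℕ)}

theorem mem_shiftFam_of_mem_iff_mem {A : Finset ℕ} (hA : i ∈ A ↔ j ∈ A) :
    A ∈ shiftFam i j F ↔ A ∈ F := by
  simp only [shiftFam, Finset.mem_image, shiftSet]
  constructor
  · rintro ⟨B, hB, h⟩
    split_ifs at h with hc
    · subst h
      have : j ∈ insert i (B.erase j) := hA.1 (Finset.mem_insert_self _ _)
      rcases Finset.mem_insert.1 this with h | h
      · exact absurd (h ▸ hc.1) hc.2.1
      · simp at h
    · exact h ▸ hB
  · exact fun h => ⟨A, h, if_neg fun hc => hc.2.1 (hA.2 hc.1)⟩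

variable {X : Finset ℕ}

theorem insert_left_mem_shiftFam (hij : i ≠ j) (hi : i ∉ X) (hj : j ∉ X) :
    insert i X ∈ shiftFam i j F ↔ insert i X ∈ F ∨ insert j X ∈ F := by
  have hjX : (insert j X).erase j = X := Finset.erase_insert hj
  simp only [shiftFam, Finset.mem_image, shiftSet]
  constructor
  · rintro ⟨B, hB, h⟩
    split_ifs at h with hc
    · have hX : B.erase j = X := by
        rw [← Finset.erase_insert hi, ← h, Finset.erase_insert]
        simp [hc.2.1]
      right
      rwa [← hX, Finset.insert_erase hc.1]
    · exact Or.inl (h ▸ hB)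
  · intro h
    by_cases h1 : insert i X ∈ F
    · exact ⟨_, h1, if_neg (by simp)⟩
    · refine ⟨_, h.resolve_left h1, ?_⟩
      rw [hjX, if_pos]
      simp [hij, hi, h1]

theorem insert_right_mem_shiftFam (hij : i ≠ j) (hi : i ∉ X) (hj : j ∉ X) :
    insert j X ∈ shiftFam i j F ↔ insert i X ∈ F ∧ insert j X ∈ F := by
  have hjX : (insert j X).erase j = X := Finset.erase_insert hj
  simp only [shiftFam, Finset.mem_image, shiftSet]
  constructor
  · rintro ⟨B, hB, h⟩
    split_ifs at h with hc
    · have : i ∈ insert j X := h ▸ Finset.mem_insert_self _ _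
      simp [hij, hi] at this
    · subst h
      rw [hjX] at hc
      simp [hij, hi] at hc
      exact ⟨hc, hB⟩
  · rintro ⟨h1, h2⟩
    refine ⟨_, h2, if_neg ?_⟩
    rw [hjX]
    simp [h1]

/-- Two families agree if they agree on each of the three kinds of sets distinguished by
`i` and `j`. -/
theorem family_ext (i j : ℕ) {G : Finset (Finset ℕ)}
    (h : ∀ A, (i ∈ A ↔ j ∈ A) → (A ∈ F ↔ A ∈ G))
    (hl : ∀ X, i ∉ X → j ∉ X → (insert i X ∈ F ↔ insert i X ∈ G))
    (hr : ∀ X, i ∉ X → j ∉ X → (insert j X ∈ F ↔ insert j X ∈ G)) : F = G := by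
  ext A
  by_cases hi : i ∈ A <;> by_cases hj : j ∈ A
  · exact h A (by simp [hi, hj])
  · simpa [Finset.insert_erase hi] using hl (A.erase i) (by simp) (by simp [hj])
  · simpa [Finset.insert_erase hj] using hr (A.erase j) (by simp [hi]) (by simp)
  · exact h A (by simp [hi, hj])

end Shift

/-- The `k`-subsets of `[N]` that meet `T` in at least `s` elements. -/
abbrev thresholdFamily (N k s : ℕ) (T : Finset ℕ) : Finset (Finset ℕ) :=
  ((Finset.Icc 1 N).powersetCard k).filter (fun A => s ≤ (A ∩ T).card)

theorem mem_thresholdFamily {N k s : ℕ} {T A : Finset ℕ} :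
    A ∈ thresholdFamily N k s T ↔ A ⊆ Finset.Icc 1 N ∧ A.card = k ∧ s ≤ (A ∩ T).card := by
  simp [thresholdFamily, Finset.mem_powersetCard, and_assoc]

theorem insert_mem_thresholdFamily {N k s a : ℕ} {T X : Finset ℕ} (ha : a ∉ X) :
    insert a X ∈ thresholdFamily N k s T ↔
      a ∈ Finset.Icc 1 N ∧ X ⊆ Finset.Icc 1 N ∧ X.card + 1 = k ∧
        s ≤ (X ∩ T).card + (if a ∈ T then 1 else 0) := by
  rw [mem_thresholdFamily, Finset.insert_subset_iff, Finset.card_insert_of_notMem ha, and_assoc]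
  split_ifs with h
  · rw [Finset.insert_inter_of_mem h, Finset.card_insert_of_notMem (by simp [ha])]
  · rw [Finset.insert_inter_of_notMem h, add_zero]

/-- The sets `X` avoiding `i` and `j` for which `X ∪ {i}` is a `k`-subset of `[N]` meeting `T ∋ i`
in exactly `s` elements. -/
structure IsCritical (N k s i j : ℕ) (T X : Finset ℕ) : Prop where
  subset : X ⊆ Finset.Icc 1 N
  left_notMem : i ∉ X
  right_notMem : j ∉ X
  card_add_one : X.card + 1 = k
  card_inter_add_one : (X ∩ T).card + 1 = s

section Family

variable {N k s i j : ℕ} {T X : Finset ℕ} {F : Finset (Finset ℕ)}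

theorem mem_Icc_of_insert_mem {a : ℕ} (hF : F ⊆ (Finset.Icc 1 N).powersetCard k)
    (h : insert a X ∈ F) : a ∈ Finset.Icc 1 N :=
  (Finset.mem_powersetCard.1 (hF h)).1 (Finset.mem_insert_self _ _)

theorem eq_thresholdFamily_of_mem_iff_mem (hij : i ≠ j)
    (hF : F ⊆ (Finset.Icc 1 N).powersetCard k)
    (hS : shiftFam i j F = thresholdFamily N k s T) (hT : i ∈ T ↔ j ∈ T) :
    F = thresholdFamily N k s T := by
  apply family_ext i j
  · intro A hA
    rw [← hS, mem_shiftFam_of_mem_iff_mem hA]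
  all_goals
    intro X hi hj
    have h1 := insert_left_mem_shiftFam (F := F) hij hi hj
    have h2 := insert_right_mem_shiftFam (F := F) hij hi hj
    have h4 := mem_Icc_of_insert_mem hF (a := j) (X := X)
    rw [hS, insert_mem_thresholdFamily hi] at h1
    rw [hS, insert_mem_thresholdFamily hj] at h2
    rw [insert_mem_thresholdFamily ‹_›]
    simp only [hT] at h1 h2 ⊢
    grind only

theorem insert_left_mem_or_insert_right_mem (hij : i ≠ j)
    (hS : shiftFam i j F = thresholdFamily N k s T) (hiT : i ∈ T) (hiN : i ∈ Finset.Icc 1 N)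
    (hX : IsCritical N k s i j T X) : insert i X ∈ F ∨ insert j X ∈ F := by
  rw [← insert_left_mem_shiftFam hij hX.left_notMem hX.right_notMem, hS,
    insert_mem_thresholdFamily hX.left_notMem, if_pos hiT]
  exact ⟨hiN, hX.subset, hX.card_add_one, hX.card_inter_add_one.ge⟩

theorem eq_thresholdFamily_of_insert_left_mem (hij : i ≠ j)
    (hF : F ⊆ (Finset.Icc 1 N).powersetCard k)
    (hS : shiftFam i j F = thresholdFamily N k s T) (hiT : i ∈ T) (hjT : j ∉ T)
    (h : ∀ X, IsCritical N k s i j T X → insert i X ∈ F) :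
    F = thresholdFamily N k s T := by
  apply family_ext i j
  · intro A hA
    rw [← hS, mem_shiftFam_of_mem_iff_mem hA]
  all_goals
    intro X hi hj
    have h1 := insert_left_mem_shiftFam (F := F) hij hi hj
    have h2 := insert_right_mem_shiftFam (F := F) hij hi hj
    have h4 := mem_Icc_of_insert_mem hF (a := j) (X := X)
    have h5 (a b c) := h X ⟨a, hi, hj, b, c⟩
    rw [hS, insert_mem_thresholdFamily hi] at h1
    rw [hS, insert_mem_thresholdFamily hj] at h2
    rw [insert_mem_thresholdFamily ‹_›]
    simp only [hiT, hjT, if_true, if_false, add_zero] at h1 h2 ⊢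
    have h6 : s ≤ (X ∩ T).card + 1 ↔ s ≤ (X ∩ T).card ∨ (X ∩ T).card + 1 = s := by omega
    grind only

theorem eq_thresholdFamily_of_insert_left_notMem (hij : i ≠ j) (hiN : i ∈ Finset.Icc 1 N)
    (hjN : j ∈ Finset.Icc 1 N)
    (hS : shiftFam i j F = thresholdFamily N k s T) (hiT : i ∈ T) (hjT : j ∉ T)
    (h : ∀ X, IsCritical N k s i j T X → insert i X ∉ F) :
    F = thresholdFamily N k s (insert j (T.erase i)) := by
  have card_eq {X : Finset ℕ} (hi : i ∉ X) (hj : j ∉ X) : X ∩ insert j (T.erase i) = X ∩ T := by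
    ext x; simp; grind
  apply family_ext i j
  · intro A hA
    rw [← mem_shiftFam_of_mem_iff_mem hA, hS, mem_thresholdFamily, mem_thresholdFamily]
    suffices (A ∩ insert j (T.erase i)).card = (A ∩ T).card by rw [this]
    by_cases hi : i ∈ A
    · rw [Finset.inter_insert_of_mem (hA.1 hi), Finset.card_insert_of_notMem (by simp [hjT]),
        Finset.inter_erase, Finset.card_erase_add_one (by simp [hi, hiT])]
    · rw [card_eq hi (fun hj => hi (hA.2 hj))]
  all_goals
    intro X hi hj
    have h1 := insert_left_mem_shiftFam (F := F) hij hi hj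
    have h2 := insert_right_mem_shiftFam (F := F) hij hi hj
    have h5 (a b c) := h X ⟨a, hi, hj, b, c⟩
    rw [hS, insert_mem_thresholdFamily hi] at h1
    rw [hS, insert_mem_thresholdFamily hj] at h2
    rw [insert_mem_thresholdFamily ‹_›, card_eq hi hj]
    have h7 : i ∉ insert j (T.erase i) := by simp [hij]
    have h8 : j ∈ insert j (T.erase i) := by simp
    simp only [hjT, h7, h8, if_true, if_false, add_zero, hiT] at h1 h2 ⊢
    have h6 : s ≤ (X ∩ T).card + 1 ↔ s ≤ (X ∩ T).card ∨ (X ∩ T).card + 1 = s := by omega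
    grind only

end Family

/-- A subset of `[N]` with prescribed trace `D` on `T` and `a` further elements outside `W`. -/
theorem exists_subset_Icc_inter_eq {N a : ℕ} {T D W : Finset ℕ} (hT : T ⊆ Finset.Icc 1 N)
    (hD : D ⊆ T) (hN : a + (W ∪ T).card ≤ N) :
    ∃ Y ⊆ Finset.Icc 1 N, Y ∩ T = D ∧ Disjoint (Y \ T) W ∧ Y.card = D.card + a := by
  have h : a ≤ (Finset.Icc 1 N \ (W ∪ T)).card := by
    have := Finset.le_card_sdiff (W ∪ T) (Finset.Icc 1 N)
    rw [Nat.card_Icc] at this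
    omega
  obtain ⟨E, hE, hEa⟩ := Finset.exists_subset_card_eq h
  have hE' : ∀ x ∈ E, x ∈ Finset.Icc 1 N ∧ x ∉ W ∧ x ∉ T := by
    intro x hx
    simpa only [Finset.mem_sdiff, Finset.mem_union, not_or] using hE hx
  have hdisj : Disjoint D E :=
    Finset.disjoint_left.2 fun x hx hxE => (hE' x hxE).2.2 (hD hx)
  refine ⟨D ∪ E, ?_, ?_, ?_, ?_⟩
  · exact Finset.union_subset (hD.trans hT) fun x hx => (hE' x hx).1
  · ext x
    have := hE' x
    have := @hD x
    simp only [Finset.mem_inter, Finset.mem_union]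
    grind only
  · rw [Finset.disjoint_left]
    intro x hx
    have := hE' x
    have := @hD x
    simp only [Finset.mem_sdiff, Finset.mem_union] at hx
    grind only
  · rw [Finset.card_union_of_disjoint hdisj, hEa]

theorem not_right_mem_left_notMem {N k s i j : ℕ} {T : Finset ℕ} {F : Finset (Finset ℕ)}
    (hij : i ≠ j) (hs : 1 ≤ s) (hsk : s ≤ k) (hsT : s ≤ T.card) (hT : T ⊆ Finset.Icc 1 N)
    (hN : k - s + T.card + 1 ≤ N)
    (hS : shiftFam i j F = thresholdFamily N k s T) : ¬ (j ∈ T ∧ i ∉ T) := by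
  rintro ⟨hj, hi⟩
  obtain ⟨D, hjD, hDT, hD⟩ := Finset.exists_subsuperset_card_eq
    (Finset.singleton_subset_iff.2 hj) (by simpa using hs) hsT
  have hjD : j ∈ D := hjD (Finset.mem_singleton_self j)
  obtain ⟨A, hA, hAT, hAi, hAk⟩ := exists_subset_Icc_inter_eq (a := k - s) (W := {i}) hT hDT (by
    rw [Finset.singleton_union, Finset.card_insert_of_notMem hi]; omega)
  have hjA : j ∈ A := (Finset.mem_inter.1 (hAT ▸ hjD)).1
  have hiA : i ∉ A := by
    simpa [hi] using hAi
  have hiX : i ∉ A.erase j := by simp [hiA]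
  have hjX : j ∉ A.erase j := by simp
  have h : insert j (A.erase j) ∈ shiftFam i j F := by
    rw [Finset.insert_erase hjA, hS, mem_thresholdFamily]
    exact ⟨hA, by omega, by rw [hAT, hD]⟩
  have h2 : insert i (A.erase j) ∈ shiftFam i j F :=
    (insert_left_mem_shiftFam hij hiX hjX).2
      (Or.inl ((insert_right_mem_shiftFam hij hiX hjX).1 h).1)
  rw [hS, insert_mem_thresholdFamily hiX, if_neg hi, Finset.erase_inter, hAT,
    Finset.card_erase_of_mem hjD] at h2
  omega

/-- Two sets that are close to each other have a common almost disjoint critical set. -/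
theorem exists_isCritical_card_inter_lt {N l t r i j : ℕ} {T X₁ X₂ : Finset ℕ}
    (hr : t + r ≤ l) (hT : T ⊆ Finset.Icc 1 N) (hTcard : T.card = t + 2 * r)
    (hiT : i ∈ T) (hjT : j ∉ T) (ht : 1 ≤ t)
    (h₁ : (X₁ ∩ T).card + 1 = t + r) (h₂ : (X₂ ∩ T).card + 1 = t + r)
    (hi₁ : i ∉ X₁) (hi₂ : i ∉ X₂)
    (hinter : (T.erase i \ (X₁ ∩ X₂)).card + 1 ≤ t + r)
    (hunion : ((X₁ ∪ X₂) \ T).card + l + r + 1 ≤ N) :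
    ∃ Y, IsCritical N l (t + r) i j T Y ∧ (X₁ ∩ Y).card < t ∧ (X₂ ∩ Y).card < t := by
  have hTi : (T.erase i).card = t + 2 * r - 1 := by rw [Finset.card_erase_of_mem hiT, hTcard]
  obtain ⟨D, hD1, hD2, hD⟩ := Finset.exists_subsuperset_card_eq (n := t + r - 1)
    (Finset.sdiff_subset (s := T.erase i) (t := X₁ ∩ X₂)) (by omega) (by omega)
  obtain ⟨Y, hY, hYT, hYW, hYc⟩ := exists_subset_Icc_inter_eq (N := N) (T := T) (D := D)
    (a := l - (t + r)) (W := insert j ((X₁ ∪ X₂) \ T)) hT (hD2.trans (Finset.erase_subset _ _)) (by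
      have := Finset.card_union_le (insert j ((X₁ ∪ X₂) \ T)) T
      have := Finset.card_insert_le j ((X₁ ∪ X₂) \ T)
      omega)
  have hYW' : ∀ x ∈ Y, x ∉ T → x ≠ j ∧ x ∉ X₁ ∧ x ∉ X₂ := by
    intro x hx hxT
    have := Finset.disjoint_left.1 hYW (Finset.mem_sdiff.2 ⟨hx, hxT⟩)
    simp only [Finset.mem_insert, Finset.mem_sdiff, Finset.mem_union] at this
    grind only
  have small (X : Finset ℕ) (hX : (X ∩ T).card + 1 = t + r) (hiX : i ∉ X)
      (hXs : T.erase i \ X ⊆ D) (hXY : ∀ x ∈ Y, x ∉ T → x ∉ X) : (X ∩ Y).card < t := by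
    have e1 : X ∩ Y ⊆ D \ (T.erase i \ X) := by
      intro x hx
      have hx' := Finset.mem_inter.1 hx
      have hxT : x ∈ T := by
        by_contra h
        exact hXY x hx'.2 h hx'.1
      simp only [Finset.mem_sdiff, ← hYT, Finset.mem_inter]
      tauto
    have e2 : T.erase i ∩ X = X ∩ T := by
      ext x; simp; grind
    have e3 := Finset.card_sdiff_add_card_inter (T.erase i) X
    have e4 := Finset.card_le_card e1
    rw [Finset.card_sdiff_of_subset hXs] at e4
    rw [e2] at e3
    omega
  refine ⟨Y, ⟨hY, fun h => ?_, fun h => (hYW' j h hjT).1 rfl, by omega, by rw [hYT]; omega⟩,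
    small X₁ h₁ hi₁ (fun x hx => hD1 ?_) (fun x hx hxT => (hYW' x hx hxT).2.1),
    small X₂ h₂ hi₂ (fun x hx => hD1 ?_) (fun x hx hxT => (hYW' x hx hxT).2.2)⟩
  · have : i ∈ D := hYT ▸ Finset.mem_inter.2 ⟨h, hiT⟩
    simpa using hD2 this
  all_goals
    simp only [Finset.mem_sdiff, Finset.mem_inter] at hx ⊢
    grind only

/-- For sets with equally large traces, an exchange step inside or outside `T` reduces the
distance. -/
theorem exists_exchange {T X Z : Finset ℕ} (hcard : X.card = Z.card)
    (hT : (X ∩ T).card = (Z ∩ T).card) (hne : X ≠ Z) :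
    ∃ x ∈ X \ Z, ∃ y ∈ Z \ X, (x ∈ T ↔ y ∈ T) := by
  have h1 := Finset.card_inter_add_card_sdiff X T
  have h2 := Finset.card_inter_add_card_sdiff Z T
  have aux {P Q : Finset ℕ} (h : P.card = Q.card) (hPQ : P ≠ Q) :
      ∃ x ∈ P \ Q, ∃ y ∈ Q \ P, True := by
    obtain ⟨x, hx⟩ := Finset.sdiff_nonempty.2 fun hs => hPQ (Finset.eq_of_subset_of_card_le hs h.ge)
    obtain ⟨y, hy⟩ := Finset.sdiff_nonempty.2 fun hs =>
      hPQ (Finset.eq_of_subset_of_card_le hs h.le).symm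
    exact ⟨x, hx, y, hy, trivial⟩
  by_cases h : X ∩ T = Z ∩ T
  · obtain ⟨x, hx, y, hy, -⟩ := aux (P := X \ T) (Q := Z \ T) (by omega) fun h' => hne (by
      rw [← Finset.sdiff_union_inter X T, h, h', Finset.sdiff_union_inter])
    simp only [Finset.mem_sdiff] at hx hy ⊢
    exact ⟨x, by tauto, y, by tauto⟩
  · obtain ⟨x, hx, y, hy, -⟩ := aux hT h
    simp only [Finset.mem_sdiff, Finset.mem_inter] at hx hy ⊢
    exact ⟨x, by tauto, y, by tauto⟩

section Connectivity

variable {N M k l t r i j : ℕ} {T : Finset ℕ}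

theorem IsCritical.card_sdiff {X : Finset ℕ} (hX : IsCritical N k (t + r) i j T X) :
    (X \ T).card + (t + r) = k := by
  have := Finset.card_inter_add_card_sdiff X T
  have := hX.card_add_one
  have := hX.card_inter_add_one
  omega

theorem IsCritical.card_erase_sdiff {X : Finset ℕ} (hX : IsCritical N k (t + r) i j T X)
    (hTcard : T.card = t + 2 * r) (hiT : i ∈ T) : (T.erase i \ X).card = r := by
  have e2 : T.erase i ∩ X = X ∩ T := by
    ext x
    have := hX.left_notMem
    simp; grind
  have e3 := Finset.card_sdiff_add_card_inter (T.erase i) X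
  rw [e2, Finset.card_erase_of_mem hiT] at e3
  have := hX.card_inter_add_one
  omega

/-- A property of critical sets that is transferred along almost disjoint pairs, in both
directions, is constant. -/
theorem isCritical_transfer (ht : 2 ≤ t) (htl : t + r ≤ l)
    (hM : k + l + 2 ≤ M + t) (hT : T ⊆ Finset.Icc 1 M)
    (hTcard : T.card = t + 2 * r) (hiT : i ∈ T) (hjT : j ∉ T) {p q : Finset ℕ → Prop}
    (hpq : ∀ X Y, IsCritical N k (t + r) i j T X → IsCritical M l (t + r) i j T Y →
      (X ∩ Y).card < t → (p X ↔ q Y))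
    {X Z : Finset ℕ} (hX : IsCritical N k (t + r) i j T X) (hZ : IsCritical N k (t + r) i j T Z)
    (hp : p X) : p Z := by
  induction h : (X \ Z).card using Nat.strong_induction_on generalizing X with
  | _ d ih =>
  by_cases hne : X = Z
  · exact hne ▸ hp
  obtain ⟨x, hx, y, hy, hxy⟩ := exists_exchange (T := T)
    (Nat.succ_injective (hX.card_add_one.trans hZ.card_add_one.symm))
    (Nat.succ_injective (hX.card_inter_add_one.trans hZ.card_inter_add_one.symm)) hne
  rw [Finset.mem_sdiff] at hx hy
  have hyX : y ∉ X.erase x := by simp [hy.2]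
  have hWcard : (insert y (X.erase x)).card = X.card := by
    rw [Finset.card_insert_of_notMem hyX, Finset.card_erase_add_one hx.1]
  have hWT : (insert y (X.erase x) ∩ T).card = (X ∩ T).card := by
    by_cases hyT : y ∈ T
    · rw [Finset.insert_inter_of_mem hyT, Finset.card_insert_of_notMem (by simp [hy.2]),
        Finset.erase_inter, Finset.card_erase_add_one (by simp [hx.1, hxy.2 hyT])]
    · rw [Finset.insert_inter_of_notMem hyT, Finset.erase_inter,
        Finset.erase_eq_of_notMem (by simp [hxy, hyT])]
  have hW : IsCritical N k (t + r) i j T (insert y (X.erase x)) := by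
    refine ⟨?_, ?_, ?_, hWcard ▸ hX.card_add_one, hWT ▸ hX.card_inter_add_one⟩
    · exact Finset.insert_subset (hZ.subset hy.1) ((Finset.erase_subset _ _).trans hX.subset)
    · have := hX.left_notMem
      have := hZ.left_notMem
      simp; grind
    · have := hX.right_notMem
      have := hZ.right_notMem
      simp; grind
  have hXT := hX.card_sdiff
  have hTX := hX.card_erase_sdiff hTcard hiT
  obtain ⟨Y, hY, hXY, hWY⟩ := exists_isCritical_card_inter_lt (N := M) (l := l) (j := j) htl hT
    hTcard hiT hjT (by omega) hX.card_inter_add_one hW.card_inter_add_one hX.left_notMem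
    hW.left_notMem (by
      have : T.erase i \ (X ∩ insert y (X.erase x)) ⊆ insert x (T.erase i \ X) := by
        intro z; simp; grind
      have := (Finset.card_le_card this).trans (Finset.card_insert_le _ _)
      omega) (by
      have : (X ∪ insert y (X.erase x)) \ T ⊆ insert y (X \ T) := by
        intro z; simp; grind
      have := (Finset.card_le_card this).trans (Finset.card_insert_le _ _)
      omega)
  refine ih _ ?_ hW ((hpq _ _ hW hY hWY).2 ((hpq _ _ hX hY hXY).1 hp)) rfl
  rw [← h]
  apply Finset.card_lt_card
  rw [Finset.ssubset_iff]
  refine ⟨x, by simp; grind, ?_⟩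
  intro z; simp; grind

end Connectivity

/-- Let `m, n, k, l, t, r` be positive integers with `t ≥ 2`, `k ≥ l ≥ t+r`,
`min{m,n} ≥ k+l−t+2`, and `i < j` in `[max{m,n}]`. Let `𝒜 ⊆ C([n],k)`, `ℬ ⊆ C([m],l)` be
cross-`t`-intersecting, and suppose for some `(t+2r)`-set `T ⊆ [min{m,n}]` we have
`S_{ij}(𝒜) = {A : |A ∩ T| ≥ t+r}` and `S_{ij}(ℬ) = {B : |B ∩ T| ≥ t+r}`. Then there is a
`(t+2r)`-set `T' ⊆ [min{m,n}]` with `𝒜 = {A : |A ∩ T'| ≥ t+r}` and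
`ℬ = {B : |B ∩ T'| ≥ t+r}`. -/
theorem statement7 (m n k l t r : ℕ)
    (hm : 1 ≤ m) (hn : 1 ≤ n) (ht : 2 ≤ t) (hr : 1 ≤ r)
    (hkl : l ≤ k) (htr : t + r ≤ l) (hmin : k + l - t + 2 ≤ min m n)
    (i j : ℕ) (hi : i ∈ Finset.Icc 1 (max m n)) (hj : j ∈ Finset.Icc 1 (max m n))
    (hij : i < j)
    (𝒜 ℬ : Finset (Finset ℕ))
    (h𝒜 : 𝒜 ⊆ (Finset.Icc 1 n).powersetCard k)
    (hℬ : ℬ ⊆ (Finset.Icc 1 m).powersetCard l)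
    (hcross : ∀ A ∈ 𝒜, ∀ B ∈ ℬ, t ≤ (A ∩ B).card)
    (T : Finset ℕ) (hT : T ⊆ Finset.Icc 1 (min m n)) (hTcard : T.card = t + 2 * r)
    (hSA : shiftFam i j 𝒜 =
      ((Finset.Icc 1 n).powersetCard k).filter (fun A => t + r ≤ (A ∩ T).card))
    (hSB : shiftFam i j ℬ =
      ((Finset.Icc 1 m).powersetCard l).filter (fun B => t + r ≤ (B ∩ T).card)) :
    ∃ T' : Finset ℕ, T' ⊆ Finset.Icc 1 (min m n) ∧ T'.card = t + 2 * r ∧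
      𝒜 = ((Finset.Icc 1 n).powersetCard k).filter (fun A => t + r ≤ (A ∩ T').card) ∧
      ℬ = ((Finset.Icc 1 m).powersetCard l).filter (fun B => t + r ≤ (B ∩ T').card) := by
  have hij' := hij.ne
  have hNn := hmin.trans (min_le_right m n)
  have hNm := hmin.trans (min_le_left m n)
  have hTn : T ⊆ Finset.Icc 1 n :=
    hT.trans (Finset.Icc_subset_Icc_right (min_le_right m n))
  have hTm : T ⊆ Finset.Icc 1 m :=
    hT.trans (Finset.Icc_subset_Icc_right (min_le_left m n))
  by_cases hTij : i ∈ T ↔ j ∈ T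
  · exact ⟨T, hT, hTcard, eq_thresholdFamily_of_mem_iff_mem hij' h𝒜 hSA hTij,
      eq_thresholdFamily_of_mem_iff_mem hij' hℬ hSB hTij⟩
  have hji := not_right_mem_left_notMem hij' (by omega) (by omega) (by omega) hTn (by omega) hSA
  obtain ⟨hiT, hjT⟩ : i ∈ T ∧ j ∉ T := by tauto
  have cross {X Y : Finset ℕ} (hX : IsCritical n k (t + r) i j T X)
      (hY : IsCritical m l (t + r) i j T Y) (hXY : (X ∩ Y).card < t) :
      insert i X ∈ 𝒜 ↔ insert i Y ∈ ℬ := by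
    have := hX.left_notMem
    have := hX.right_notMem
    have := hY.left_notMem
    have := hY.right_notMem
    have hor := insert_left_mem_or_insert_right_mem hij' hSA hiT (hTn hiT) hX
    have hor' := insert_left_mem_or_insert_right_mem hij' hSB hiT (hTm hiT) hY
    constructor
    · intro h
      refine hor'.resolve_right fun h' => ?_
      have e : insert i X ∩ insert j Y = X ∩ Y := by
        ext z; simp; grind
      have := hcross _ h _ h'
      rw [e] at this
      omega
    · intro h
      refine hor.resolve_right fun h' => ?_
      have e : insert j X ∩ insert i Y = X ∩ Y := by
        ext z; simp; grind
      have := hcross _ h' _ h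
      rw [e] at this
      omega
  have nbrA {X : Finset ℕ} (hX : IsCritical n k (t + r) i j T X) :
      ∃ Y, IsCritical m l (t + r) i j T Y ∧ (X ∩ Y).card < t := by
    have h1 := hX.card_sdiff
    have h2 := hX.card_erase_sdiff hTcard hiT
    obtain ⟨Y, hY, hXY, -⟩ := exists_isCritical_card_inter_lt (N := m) (l := l) (j := j)
      htr hTm hTcard hiT hjT (by omega) hX.card_inter_add_one hX.card_inter_add_one
      hX.left_notMem hX.left_notMem (by rw [Finset.inter_self]; omega)
      (by rw [Finset.union_self]; omega)
    exact ⟨Y, hY, hXY⟩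
  have nbrB {Y : Finset ℕ} (hY : IsCritical m l (t + r) i j T Y) :
      ∃ X, IsCritical n k (t + r) i j T X ∧ (X ∩ Y).card < t := by
    have h1 := hY.card_sdiff
    have h2 := hY.card_erase_sdiff hTcard hiT
    obtain ⟨X, hX, hXY, -⟩ := exists_isCritical_card_inter_lt (N := n) (l := k) (j := j)
      (htr.trans hkl) hTn hTcard hiT hjT (by omega) hY.card_inter_add_one hY.card_inter_add_one
      hY.left_notMem hY.left_notMem (by rw [Finset.inter_self]; omega)
      (by rw [Finset.union_self]; omega)
    exact ⟨X, hX, Finset.inter_comm Y X ▸ hXY⟩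
  by_cases hex : ∃ X, IsCritical n k (t + r) i j T X ∧ insert i X ∈ 𝒜
  · obtain ⟨X, hX, hXA⟩ := hex
    have allA : ∀ Z, IsCritical n k (t + r) i j T Z → insert i Z ∈ 𝒜 := fun Z hZ =>
      isCritical_transfer (p := fun X => insert i X ∈ 𝒜) (q := fun Y => insert i Y ∈ ℬ)
        ht htr (by omega) hTm hTcard hiT hjT (fun _ _ => cross) hX hZ hXA
    refine ⟨T, hT, hTcard,
      eq_thresholdFamily_of_insert_left_mem hij' h𝒜 hSA hiT hjT allA,
      eq_thresholdFamily_of_insert_left_mem hij' hℬ hSB hiT hjT fun Y hY => ?_⟩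
    obtain ⟨Z, hZ, hZY⟩ := nbrB hY
    exact (cross hZ hY hZY).1 (allA Z hZ)
  · have noneA : ∀ Z, IsCritical n k (t + r) i j T Z → insert i Z ∉ 𝒜 :=
      fun Z hZ h => hex ⟨Z, hZ, h⟩
    have noneB : ∀ Y, IsCritical m l (t + r) i j T Y → insert i Y ∉ ℬ := by
      intro Y hY h
      obtain ⟨Z, hZ, hZY⟩ := nbrB hY
      exact noneA Z hZ ((cross hZ hY hZY).2 h)
    obtain ⟨X, hX⟩ : ∃ X, IsCritical n k (t + r) i j T X := by
      obtain ⟨D, hDT, hD⟩ := Finset.exists_subset_card_eq (s := T.erase i) (n := t + r - 1) (by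
        rw [Finset.card_erase_of_mem hiT]; omega)
      obtain ⟨X, hX, hXT, hXj, hXk⟩ := exists_subset_Icc_inter_eq (a := k - (t + r)) (W := {j})
        hTn (hDT.trans (Finset.erase_subset _ _)) (by
          rw [Finset.singleton_union, Finset.card_insert_of_notMem hjT]; omega)
      refine ⟨X, hX, fun h => ?_, by simpa [hjT] using hXj, by omega, by rw [hXT]; omega⟩
      have : i ∈ D := hXT ▸ Finset.mem_inter.2 ⟨h, hiT⟩
      simpa using hDT this
    obtain ⟨Y, hY, -⟩ := nbrA hX
    have hjn : j ∈ Finset.Icc 1 n := mem_Icc_of_insert_mem h𝒜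
      ((insert_left_mem_or_insert_right_mem hij' hSA hiT (hTn hiT) hX).resolve_left
        (noneA X hX))
    have hjm : j ∈ Finset.Icc 1 m := mem_Icc_of_insert_mem hℬ
      ((insert_left_mem_or_insert_right_mem hij' hSB hiT (hTm hiT) hY).resolve_left
        (noneB Y hY))
    refine ⟨insert j (T.erase i), ?_, ?_,
      eq_thresholdFamily_of_insert_left_notMem hij' (hTn hiT) hjn hSA hiT hjT noneA,
      eq_thresholdFamily_of_insert_left_notMem hij' (hTm hiT) hjm hSB hiT hjT noneB⟩
    · refine Finset.insert_subset ?_ ((Finset.erase_subset _ _).trans hT)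
      rw [Finset.mem_Icc] at hjn hjm ⊢
      exact ⟨hjn.1, le_min hjm.2 hjn.2⟩
    · rw [Finset.card_insert_of_notMem (by simp [hjT]), Finset.card_erase_add_one hiT, hTcard]
end

section
/- Let 𝒜 ⊆ C([n],k) and ℬ ⊆ C([m],l) be maximal left-compressed cross-t-intersecting families with min{m,n} > k+l−t. Let g(𝒜) ∈ G_*(𝒜) and g(ℬ) ∈ G_*(ℬ) be chosen so that s := max{s⁺(g(𝒜)), s⁺(g(ℬ))} is minimal over all such choices. If g*_i(𝒜) ≠ ∅ for some t ≤ i ≤ k, then 𝒜₁ = 𝒜 ∪ 𝒟(g*_i(𝒜)') ⊆ C([n],k) and ℬ₁ = ℬ \ 𝒟(g*_{s+t−i}(ℬ)) ⊆ C([m],l) are cross-t-intersecting families with |𝒜₁| = |𝒜| + |g*_i(𝒜)|·C(n−s, k−i+1) and |ℬ₁| = |ℬ| − |g*_{s+t−i}(ℬ)|·C(m−s, l+i−s−t), where 𝒟 is taken with respect to uniformity k inside [n] for the 𝒜-side and with respect to uniformity l inside [m] for the ℬ-side. -/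
/-- `𝒜` and `ℬ` are cross-`t`-intersecting. -/
def CrossInt (t : ℕ) (𝒜 ℬ : Finset (Finset ℕ)) : Prop :=
  ∀ A ∈ 𝒜, ∀ B ∈ ℬ, t ≤ (A ∩ B).card

/-- `F` is left-compressed (on ground set `[n]`). -/
def LeftCompressed (n : ℕ) (F : Finset (Finset ℕ)) : Prop :=
  ∀ i j : ℕ, 1 ≤ i → i < j → j ≤ n → shiftFam i j F = F

/-- The cross-`t`-intersecting pair `(𝒜, ℬ)` with `𝒜 ⊆ C([n],k)`, `ℬ ⊆ C([m],l)` is maximal: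
no cross-`t`-intersecting pair extending it has strictly larger product of sizes. -/
def MaximalPair (n m k l t : ℕ) (𝒜 ℬ : Finset (Finset ℕ)) : Prop :=
  ¬ ∃ 𝒜₁ ℬ₁ : Finset (Finset ℕ),
      𝒜₁ ⊆ (Finset.Icc 1 n).powersetCard k ∧ ℬ₁ ⊆ (Finset.Icc 1 m).powersetCard l ∧
      𝒜 ⊆ 𝒜₁ ∧ ℬ ⊆ ℬ₁ ∧ CrossInt t 𝒜₁ ℬ₁ ∧ 𝒜.card * ℬ.card < 𝒜₁.card * ℬ₁.card

/-- `s⁺(ℰ) = max_{E ∈ ℰ} max E`. -/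
def sPlusFam (ℰ : Finset (Finset ℕ)) : ℕ := ℰ.sup (fun E => E.sup id)

/-- `g` is a generating set of `F ⊆ C([n],k)`: its members are subsets of `[n]` of size at
most `k`, and `𝒰(g) ∩ C([n],k) = F`. -/
def IsGenSet (n k : ℕ) (F g : Finset (Finset ℕ)) : Prop :=
  (∀ E ∈ g, E ⊆ Finset.Icc 1 n) ∧ (∀ E ∈ g, E.card ≤ k) ∧
  ((Finset.Icc 1 n).powersetCard k).filter (fun A => ∃ E ∈ g, E ⊆ A) = F

/-- `g ∈ G_*(F)`: a generating set of `F` all of whose members are minimal under inclusion. -/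
def GStar (n k : ℕ) (F g : Finset (Finset ℕ)) : Prop :=
  IsGenSet n k F g ∧ ∀ E ∈ g, ∀ E' ∈ g, E' ⊆ E → E' = E

/-- `g*_i = {E ∈ g : s ∈ E, |E| = i}` (with respect to the value `s`). -/
def gStar (s i : ℕ) (g : Finset (Finset ℕ)) : Finset (Finset ℕ) :=
  g.filter (fun E => s ∈ E ∧ E.card = i)

/-- `g*_i' = {E \ {s} : E ∈ g*_i}`. -/
def gStarPrime (s i : ℕ) (g : Finset (Finset ℕ)) : Finset (Finset ℕ) :=
  (gStar s i g).image (fun E => E.erase s)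

/-- `𝒟(ℰ) = ⋃_{E ∈ ℰ} {B ∈ C([n],k) : B ∩ [s⁺(E)] = E}` (uniformity `k` inside `[n]`). -/
def DFam (n k : ℕ) (ℰ : Finset (Finset ℕ)) : Finset (Finset ℕ) :=
  ((Finset.Icc 1 n).powersetCard k).filter
    (fun B => ∃ E ∈ ℰ, B ∩ Finset.Icc 1 (E.sup id) = E)

open Finset in
theorem LeftCompressed.shift_mem {n : ℕ} {F : Finset (Finset ℕ)} (h : LeftCompressed n F)
    {i j : ℕ} (hi : 1 ≤ i) (hij : i < j) (hj : j ≤ n) {A : Finset ℕ} (hA : A ∈ F)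
    (hjA : j ∈ A) (hiA : i ∉ A) : insert i (A.erase j) ∈ F := by
  by_contra hc
  have hmem : shiftSet F i j A ∈ shiftFam i j F := mem_image_of_mem _ hA
  rw [h i j hi hij hj, shiftSet, if_pos ⟨hjA, hiA, hc⟩] at hmem
  exact hc hmem

open Finset in
/-- If all `k`-sets of `[n]` above `E` lie in a left-compressed family, so do those above
`insert x (E.erase s)` for `x < s`. -/
theorem LeftCompressed.mem_of_insert_erase_subset {n k : ℕ} {F : Finset (Finset ℕ)}
    (h : LeftCompressed n F) {E : Finset ℕ} {x s : ℕ} (hx : 1 ≤ x) (hxs : x < s) (hsn : s ≤ n)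
    (hE : ∀ A ∈ (Icc 1 n).powersetCard k, E ⊆ A → A ∈ F) {C : Finset ℕ}
    (hC : C ∈ (Icc 1 n).powersetCard k) (hEC : E.erase s ⊆ C) (hxE : x ∉ E) (hxC : x ∈ C) :
    C ∈ F := by
  rw [mem_powersetCard] at hC
  by_cases hsC : s ∈ C
  · refine hE C (mem_powersetCard.2 hC) fun y hy => ?_
    by_cases hys : y = s
    · exact hys ▸ hsC
    · exact hEC (mem_erase.2 ⟨hys, hy⟩)
  · have hsC' : s ∉ C.erase x := fun h' => hsC (mem_of_mem_erase h')
    have hmem : insert s (C.erase x) ∈ F := by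
      refine hE _ (mem_powersetCard.2 ⟨?_, ?_⟩) fun y hy => ?_
      · refine insert_subset (mem_Icc.2 ⟨by omega, hsn⟩) ((erase_subset _ _).trans hC.1)
      · rw [card_insert_of_notMem hsC', card_erase_add_one hxC, hC.2]
      · by_cases hys : y = s
        · exact hys ▸ mem_insert_self _ _
        · exact mem_insert_of_mem (mem_erase.2
            ⟨fun e => hxE (e ▸ hy), hEC (mem_erase.2 ⟨hys, hy⟩)⟩)
    have hshift := h.shift_mem hx hxs hsn hmem (mem_insert_self _ _)
      (by simp [hxs.ne])
    rwa [erase_insert hsC', insert_erase hxC] at hshift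

open Finset in
theorem exists_exchange_s9 {N c : ℕ} {E A B : Finset ℕ} (hA : A ∈ (Icc 1 N).powersetCard c)
    (hEA : E ⊆ A) (hN : (A ∪ B).card < N) {x : ℕ} (hxA : x ∈ A) (hxB : x ∈ B) (hxE : x ∉ E) :
    ∃ A' ∈ (Icc 1 N).powersetCard c, E ⊆ A' ∧ (A' ∩ B).card < (A ∩ B).card := by
  rw [mem_powersetCard] at hA
  obtain ⟨y, hy, hyAB⟩ := exists_mem_notMem_of_card_lt_card (s := A ∪ B) (t := Icc 1 N)
    (by simpa using hN)
  simp only [mem_union, not_or] at hyAB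
  refine ⟨insert y (A.erase x), mem_powersetCard.2
    ⟨insert_subset hy ((erase_subset _ _).trans hA.1), ?_⟩, fun z hz => ?_, ?_⟩
  · rw [card_insert_of_notMem (fun h => hyAB.1 (mem_of_mem_erase h)), card_erase_add_one hxA, hA.2]
  · exact mem_insert_of_mem (mem_erase.2 ⟨fun e => hxE (e ▸ hz), hEA hz⟩)
  · refine card_lt_card ⟨fun z hz => ?_, fun h => ?_⟩
    · simp only [mem_inter, mem_insert, mem_erase] at hz ⊢
      rcases hz with ⟨rfl | hz, hzB⟩
      · exact absurd hzB hyAB.2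
      · exact ⟨hz.2, hzB⟩
    · have := h (mem_inter.2 ⟨hxA, hxB⟩)
      simp only [mem_inter, mem_insert, mem_erase] at this
      rcases this.1 with rfl | h'
      · exact hyAB.1 hxA
      · exact h'.1 rfl

open Finset in
theorem CrossInt.le_card_inter_of_generates {n m k l t : ℕ} {𝒜 ℬ : Finset (Finset ℕ)}
    (hcross : CrossInt t 𝒜 ℬ) (hmin : k + l - t < min m n) (hkn : k ≤ n) (hlm : l ≤ m)
    {E F : Finset ℕ} (hEn : E ⊆ Icc 1 n) (hEk : E.card ≤ k) (hFm : F ⊆ Icc 1 m) (hFl : F.card ≤ l)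
    (hE : ∀ A ∈ (Icc 1 n).powersetCard k, E ⊆ A → A ∈ 𝒜)
    (hF : ∀ B ∈ (Icc 1 m).powersetCard l, F ⊆ B → B ∈ ℬ) : t ≤ (E ∩ F).card := by
  by_contra! hlt
  have key : ∀ c : ℕ, ∀ A ∈ (Icc 1 n).powersetCard k, ∀ B ∈ (Icc 1 m).powersetCard l,
      E ⊆ A → F ⊆ B → (A ∩ B).card ≠ c := by
    intro c
    induction c using Nat.strong_induction_on with
    | _ c ih =>
      intro A hA B hB hEA hFB hc
      have ht := hcross A (hE A hA hEA) B (hF B hB hFB)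
      obtain ⟨x, hx, hxEF⟩ := exists_mem_notMem_of_card_lt_card (hlt.trans_le ht)
      rw [mem_inter] at hx
      have hu := card_union_add_card_inter A B
      rw [(mem_powersetCard.1 hA).2, (mem_powersetCard.1 hB).2] at hu
      by_cases hxE : x ∈ E
      · have hxF : x ∉ F := fun h => hxEF (mem_inter.2 ⟨hxE, h⟩)
        obtain ⟨B', hB', hFB', hlt'⟩ := exists_exchange_s9 (B := A) hB hFB
          (by rw [union_comm]; omega) hx.2 hx.1 hxF
        rw [inter_comm B' A, inter_comm B A] at hlt'
        exact ih _ (hc ▸ hlt') A hA B' hB' hEA hFB' rfl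
      · obtain ⟨A', hA', hEA', hlt'⟩ := exists_exchange_s9 (B := B) hA hEA (by omega) hx.1 hx.2 hxE
        exact ih _ (hc ▸ hlt') A' hA' B hB hEA' hFB rfl
  obtain ⟨A, hEA, hAn, hAk⟩ := exists_subsuperset_card_eq hEn hEk (by simpa using hkn)
  obtain ⟨B, hFB, hBm, hBl⟩ := exists_subsuperset_card_eq hFm hFl (by simpa using hlm)
  exact key _ A (mem_powersetCard.2 ⟨hAn, hAk⟩) B (mem_powersetCard.2 ⟨hBm, hBl⟩) hEA hFB rfl

open Finset in
theorem card_filter_inter_Icc_eq {m l s : ℕ} {E : Finset ℕ} (hEs : E ⊆ Icc 1 s)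
    (hEl : E.card ≤ l) (hsm : s ≤ m) :
    (((Icc 1 m).powersetCard l).filter (fun B => B ∩ Icc 1 s = E)).card
      = (m - s).choose (l - E.card) := by
  have hdisj : ∀ C, C ⊆ Icc (s + 1) m → Disjoint E C := fun C hC =>
    disjoint_left.2 fun x hxE hxC => by
      have h₁ := mem_Icc.1 (hEs hxE)
      have h₂ := mem_Icc.1 (hC hxC)
      omega
  have himage : ((Icc 1 m).powersetCard l).filter (fun B => B ∩ Icc 1 s = E)
      = ((Icc (s + 1) m).powersetCard (l - E.card)).image (E ∪ ·) := by
    ext B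
    simp only [mem_filter, mem_powersetCard, mem_image]
    constructor
    · rintro ⟨⟨hBm, hBl⟩, rfl⟩
      refine ⟨B \ Icc 1 s, ⟨fun x hx => ?_, ?_⟩, ?_⟩
      · rw [mem_sdiff] at hx
        have h₁ := mem_Icc.1 (hBm hx.1)
        have h₂ := hx.2
        rw [mem_Icc] at h₂ ⊢
        omega
      · have := card_sdiff_add_card_inter B (Icc 1 s)
        omega
      · rw [union_comm, sdiff_union_inter]
    · rintro ⟨C, ⟨hC, hCc⟩, rfl⟩
      refine ⟨⟨union_subset (hEs.trans (Icc_subset_Icc_right hsm))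
        (hC.trans (Icc_subset_Icc_left (by omega))), ?_⟩, ?_⟩
      · rw [card_union_of_disjoint (hdisj C hC)]
        omega
      · have hCs : C ∩ Icc 1 s = ∅ := by
          ext x
          simp only [mem_inter, mem_Icc, notMem_empty, iff_false]
          intro hx
          have := mem_Icc.1 (hC hx.1)
          omega
        rw [union_inter_distrib_right, hCs, union_empty, inter_eq_left.2 hEs]
  rw [himage, card_image_of_injOn, card_powersetCard, Nat.card_Icc]
  · congr 1
    omega
  · intro C hC D hD hCD
    simp only [mem_coe, mem_powersetCard] at hC hD
    have := congrArg (· \ E) hCD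
    simpa [union_sdiff_left, sdiff_eq_self_of_disjoint (hdisj C hC.1).symm,
      sdiff_eq_self_of_disjoint (hdisj D hD.1).symm] using this

open Finset in
theorem card_filter_exists_inter_Icc_eq {m l s j : ℕ} {G : Finset (Finset ℕ)}
    (hG : ∀ E ∈ G, E ⊆ Icc 1 s ∧ E.card = j ∧ j ≤ l ∧ s ≤ m) :
    (((Icc 1 m).powersetCard l).filter (fun B => ∃ E ∈ G, B ∩ Icc 1 s = E)).card
      = G.card * (m - s).choose (l - j) := by
  rw [card_eq_sum_card_fiberwise (f := fun B => B ∩ Icc 1 s) (t := G), ← smul_eq_mul,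
    ← sum_const]
  · refine sum_congr rfl fun E hE => ?_
    obtain ⟨hEs, rfl, hjl, hsm⟩ := hG E hE
    rw [← card_filter_inter_Icc_eq hEs hjl hsm, filter_filter]
    congr 1
    refine filter_congr fun B _ => ⟨fun h => h.2, fun h => ⟨⟨E, hE, h⟩, h⟩⟩
  · intro B hB
    simp only [coe_filter, Set.mem_ofPred_eq] at hB
    obtain ⟨-, E, hE, rfl⟩ := hB
    exact hE

open Finset in
theorem IsGenSet.mem_of_subset {n k : ℕ} {F g : Finset (Finset ℕ)} (h : IsGenSet n k F g)
    {E : Finset ℕ} (hE : E ∈ g) : ∀ A ∈ (Icc 1 n).powersetCard k, E ⊆ A → A ∈ F := by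
  intro A hA hEA
  rw [← h.2.2]
  exact mem_filter.2 ⟨hA, E, hE, hEA⟩

open Finset in
theorem IsGenSet.exists_subset {n k : ℕ} {F g : Finset (Finset ℕ)} (h : IsGenSet n k F g)
    {A : Finset ℕ} (hA : A ∈ F) : ∃ E ∈ g, E ⊆ A := by
  rw [← h.2.2] at hA
  exact (mem_filter.1 hA).2

open Finset in
theorem IsGenSet.subset_Icc_of_sPlusFam_le {n k s : ℕ} {F g : Finset (Finset ℕ)}
    (h : IsGenSet n k F g) (hs : sPlusFam g ≤ s) {E : Finset ℕ} (hE : E ∈ g) : E ⊆ Icc 1 s := by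
  intro x hx
  have hxE : x ≤ E.sup id := le_sup (f := id) hx
  have hEg : E.sup id ≤ sPlusFam g := le_sup (f := fun E : Finset ℕ => E.sup id) hE
  exact mem_Icc.2 ⟨(mem_Icc.1 (h.1 E hE hx)).1, by omega⟩

open Finset in
theorem sup_id_eq_of_subset_Icc {s : ℕ} {E : Finset ℕ} (hE : E ⊆ Icc 1 s) (hs : s ∈ E) :
    E.sup id = s :=
  le_antisymm (Finset.sup_le fun _ hx => (mem_Icc.1 (hE hx)).2) (le_sup (f := id) hs)

open Finset in
/-- A member of `𝒟(g*_i')` outside the left-compressed family meets `[s]` exactly in a member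
of `g*_i'`. -/
theorem LeftCompressed.inter_Icc_eq_of_mem_DFam {n k s : ℕ} {F : Finset (Finset ℕ)}
    (h : LeftCompressed n F) {E A : Finset ℕ} (hEs : E ⊆ Icc 1 s) (hsE : s ∈ E) (hsn : s ≤ n)
    (hE : ∀ A ∈ (Icc 1 n).powersetCard k, E ⊆ A → A ∈ F)
    (hA : A ∈ (Icc 1 n).powersetCard k)
    (hAE : A ∩ Icc 1 ((E.erase s).sup id) = E.erase s) (hAF : A ∉ F) :
    A ∩ Icc 1 s = E.erase s := by
  have hsub : E.erase s ⊆ A := by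
    rw [← hAE]
    exact inter_subset_left
  ext x
  simp only [mem_inter, mem_Icc]
  constructor
  · rintro ⟨hxA, hx1, hxs⟩
    by_contra hxE
    rcases hxs.eq_or_lt with rfl | hxs
    · refine hAF (hE A hA fun y hy => ?_)
      by_cases hy' : y = x
      · exact hy' ▸ hxA
      · exact hsub (mem_erase.2 ⟨hy', hy⟩)
    · exact hAF (h.mem_of_insert_erase_subset hx1 hxs hsn hE hA hsub
        (fun hx => hxE (mem_erase.2 ⟨hxs.ne, hx⟩)) hxA)
  · intro hx
    exact ⟨hsub hx, mem_Icc.1 (hEs (mem_of_mem_erase hx))⟩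

/-- With `𝒜, ℬ, g(𝒜), g(ℬ), s` as in the generating-set setup: if
`g*_i(𝒜) ≠ ∅` for some `t ≤ i ≤ k`, then `𝒜₁ = 𝒜 ∪ 𝒟(g*_i(𝒜)') ⊆ C([n],k)` and
`ℬ₁ = ℬ \ 𝒟(g*_{s+t−i}(ℬ)) ⊆ C([m],l)` are cross-`t`-intersecting with
`|𝒜₁| = |𝒜| + |g*_i(𝒜)|·C(n−s,k−i+1)` and `|ℬ₁| = |ℬ| − |g*_{s+t−i}(ℬ)|·C(m−s,l+i−s−t)`. -/
theorem statement9 (n m k l t : ℕ)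
    (𝒜 ℬ : Finset (Finset ℕ))
    (h𝒜 : 𝒜 ⊆ (Finset.Icc 1 n).powersetCard k)
    (hℬ : ℬ ⊆ (Finset.Icc 1 m).powersetCard l)
    (hlcA : LeftCompressed n 𝒜) (hlcB : LeftCompressed m ℬ)
    (hcross : CrossInt t 𝒜 ℬ)
    (hmax : MaximalPair n m k l t 𝒜 ℬ)
    (hmin : k + l - t < min m n)
    (g𝒜 g𝓑 : Finset (Finset ℕ)) (hgA : GStar n k 𝒜 g𝒜) (hgB : GStar m l ℬ g𝓑)
    (s : ℕ) (hs : s = max (sPlusFam g𝒜) (sPlusFam g𝓑))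
    (hsmin : ∀ g𝒜' g𝓑' : Finset (Finset ℕ), GStar n k 𝒜 g𝒜' → GStar m l ℬ g𝓑' →
      s ≤ max (sPlusFam g𝒜') (sPlusFam g𝓑'))
    (i : ℕ) (hti : t ≤ i) (hik : i ≤ k)
    (hne : (gStar s i g𝒜).Nonempty) :
    (𝒜 ∪ DFam n k (gStarPrime s i g𝒜)) ⊆ (Finset.Icc 1 n).powersetCard k ∧
    (ℬ \ DFam m l (gStar s (s + t - i) g𝓑)) ⊆ (Finset.Icc 1 m).powersetCard l ∧
    CrossInt t (𝒜 ∪ DFam n k (gStarPrime s i g𝒜))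
      (ℬ \ DFam m l (gStar s (s + t - i) g𝓑)) ∧
    (𝒜 ∪ DFam n k (gStarPrime s i g𝒜)).card
      = 𝒜.card + (gStar s i g𝒜).card * (n - s).choose (k - i + 1) ∧
    ((ℬ \ DFam m l (gStar s (s + t - i) g𝓑)).card : ℤ)
      = (ℬ.card : ℤ)
        - (gStar s (s + t - i) g𝓑).card * (m - s).choose (l + i - s - t) := by
  obtain ⟨hgA, hgAmin⟩ := hgA
  obtain ⟨hgB, -⟩ := hgB
  have hAs : ∀ E ∈ g𝒜, E ⊆ Finset.Icc 1 s := fun E hE =>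
    hgA.subset_Icc_of_sPlusFam_le (by omega) hE
  have hBs : ∀ F ∈ g𝓑, F ⊆ Finset.Icc 1 s := fun F hF =>
    hgB.subset_Icc_of_sPlusFam_le (by omega) hF
  have memA : ∀ {E}, E ∈ gStar s i g𝒜 → E ∈ g𝒜 ∧ s ∈ E ∧ E.card = i := fun hE =>
    Finset.mem_filter.1 hE
  have memB : ∀ {F}, F ∈ gStar s (s + t - i) g𝓑 → F ∈ g𝓑 ∧ s ∈ F ∧ F.card = s + t - i :=
    fun hF => Finset.mem_filter.1 hF
  obtain ⟨hsn, his⟩ : s ≤ n ∧ 1 ≤ i := by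
    obtain ⟨E, hE⟩ := hne
    obtain ⟨hEg, hsE, rfl⟩ := memA hE
    exact ⟨(Finset.mem_Icc.1 (hgA.1 E hEg hsE)).2, Finset.card_pos.2 ⟨s, hsE⟩⟩
  have hnew : ∀ A ∈ DFam n k (gStarPrime s i g𝒜), A ∉ 𝒜 →
      ∃ E ∈ gStar s i g𝒜, A ∩ Finset.Icc 1 s = E.erase s := by
    intro A hA hA𝒜
    obtain ⟨hA, E', hE', hAE⟩ := Finset.mem_filter.1 hA
    obtain ⟨E, hE, rfl⟩ := Finset.mem_image.1 hE'
    obtain ⟨hEg, hsE, -⟩ := memA hE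
    exact ⟨E, hE, hlcA.inter_Icc_eq_of_mem_DFam (hAs E hEg) hsE hsn (hgA.mem_of_subset hEg)
      hA hAE hA𝒜⟩
  have hDB : DFam m l (gStar s (s + t - i) g𝓑) = ((Finset.Icc 1 m).powersetCard l).filter
      (fun B => ∃ E ∈ gStar s (s + t - i) g𝓑, B ∩ Finset.Icc 1 s = E) := by
    refine Finset.filter_congr fun B _ => exists_congr fun F => and_congr_right fun hF => ?_
    rw [sup_id_eq_of_subset_Icc (hBs F (memB hF).1) (memB hF).2.1]
  refine ⟨Finset.union_subset h𝒜 (Finset.filter_subset _ _), Finset.sdiff_subset.trans hℬ,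
    ?_, ?_, ?_⟩
  · intro A hA B hB
    rw [Finset.mem_sdiff] at hB
    by_cases hA𝒜 : A ∈ 𝒜
    · exact hcross A hA𝒜 B hB.1
    have hAD := (Finset.mem_union.1 hA).resolve_left hA𝒜
    have hAnk := Finset.mem_powersetCard.1 (Finset.mem_filter.1 hAD).1
    have hBml := Finset.mem_powersetCard.1 (hℬ hB.1)
    have hkn : k ≤ n := by simpa [hAnk.2] using Finset.card_le_card hAnk.1
    have hlm : l ≤ m := by simpa [hBml.2] using Finset.card_le_card hBml.1
    obtain ⟨E, hE, hAE⟩ := hnew A hAD hA𝒜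
    obtain ⟨hEg, hsE, hEi⟩ := memA hE
    obtain ⟨F, hFg, hFB⟩ := hgB.exists_subset hB.1
    have hEF : t ≤ (E ∩ F).card :=
      hcross.le_card_inter_of_generates hmin hkn hlm (hgA.1 E hEg) (hgA.2.1 E hEg)
        (hgB.1 F hFg) (hgB.2.1 F hFg) (hgA.mem_of_subset hEg) (hgB.mem_of_subset hFg)
    have hEA : E.erase s ⊆ A := hAE ▸ Finset.inter_subset_left
    have hle : (E ∩ F).erase s ⊆ A ∩ B := by
      rw [← Finset.erase_inter]
      exact Finset.inter_subset_inter hEA hFB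
    by_cases hsF : s ∉ F
    · rw [Finset.erase_eq_of_notMem (fun h => hsF (Finset.mem_inter.1 h).2)] at hle
      exact hEF.trans (Finset.card_le_card hle)
    rw [not_not] at hsF
    have hcard := Finset.card_erase_add_one (Finset.mem_inter.2 ⟨hsE, hsF⟩)
    rcases hEF.lt_or_eq with hlt | heq
    · exact le_trans (by omega) (Finset.card_le_card hle)
    have hunion : E ∪ F = Finset.Icc 1 s := by
      refine (Finset.union_subset (hAs E hEg) (hBs F hFg)).antisymm fun x hx => ?_
      by_contra hxEF
      rw [Finset.mem_union, not_or] at hxEF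
      rw [Finset.mem_Icc] at hx
      have hxs : x < s := hx.2.lt_of_ne fun h => hxEF.1 (h ▸ hsE)
      have hsm : s ≤ m := (Finset.mem_Icc.1 (hgB.1 F hFg hsF)).2
      have hsFx : s ∉ F.erase s := Finset.notMem_erase s F
      have hxF : x ∉ F.erase s := fun h => hxEF.2 (Finset.mem_of_mem_erase h)
      have := hcross.le_card_inter_of_generates hmin hkn hlm (hgA.1 E hEg) (hgA.2.1 E hEg)
        (F := insert x (F.erase s))
        (Finset.insert_subset (Finset.mem_Icc.2 ⟨hx.1, by omega⟩)
          ((Finset.erase_subset _ _).trans (hgB.1 F hFg)))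
        (by
          rw [Finset.card_insert_of_notMem hxF, Finset.card_erase_add_one hsF]
          exact hgB.2.1 F hFg)
        (hgA.mem_of_subset hEg)
        (fun C hC hFC => hlcB.mem_of_insert_erase_subset hx.1 hxs hsm (hgB.mem_of_subset hFg) hC
          ((Finset.subset_insert _ _).trans hFC) hxEF.2 (hFC (Finset.mem_insert_self _ _)))
      rw [Finset.inter_insert_of_notMem hxEF.1, Finset.inter_erase] at this
      omega
    have hFcard : F.card = s + t - i := by
      have := Finset.card_union_add_card_inter E F
      rw [hunion, Nat.card_Icc] at this
      omega
    have hFB' : ¬ B ∩ Finset.Icc 1 s ⊆ F := fun h => hB.2 <| by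
      rw [hDB]
      exact Finset.mem_filter.2 ⟨hℬ hB.1, F, Finset.mem_filter.2 ⟨hFg, hsF, hFcard⟩,
        h.antisymm (Finset.subset_inter hFB (hBs F hFg))⟩
    obtain ⟨y, hy, hyF⟩ := Finset.not_subset.1 hFB'
    rw [Finset.mem_inter] at hy
    have hyE : y ∈ E := (Finset.mem_union.1 (hunion.symm ▸ hy.2)).resolve_right hyF
    have hyA : y ∈ A := hEA (Finset.mem_erase.2 ⟨fun h => hyF (h ▸ hsF), hyE⟩)
    have hy' : y ∉ (E ∩ F).erase s := fun h =>
      hyF (Finset.mem_inter.1 (Finset.mem_of_mem_erase h)).2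
    have := Finset.card_le_card (Finset.insert_subset (Finset.mem_inter.2 ⟨hyA, hy.1⟩) hle)
    rw [Finset.card_insert_of_notMem hy'] at this
    omega
  · have hU : 𝒜 ∪ DFam n k (gStarPrime s i g𝒜) = 𝒜 ∪ ((Finset.Icc 1 n).powersetCard k).filter
        (fun B => ∃ E ∈ gStarPrime s i g𝒜, B ∩ Finset.Icc 1 s = E) := by
      ext A
      simp only [Finset.mem_union]
      refine or_congr_right' fun hA𝒜 => ⟨fun hA => ?_, fun hA => ?_⟩
      · obtain ⟨E, hE, hAE⟩ := hnew A hA hA𝒜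
        exact Finset.mem_filter.2 ⟨(Finset.mem_filter.1 hA).1, _,
          Finset.mem_image_of_mem _ hE, hAE⟩
      · obtain ⟨hA, E', hE', rfl⟩ := Finset.mem_filter.1 hA
        refine Finset.mem_filter.2 ⟨hA, _, hE', ?_⟩
        ext x
        simp only [Finset.mem_inter, Finset.mem_Icc]
        refine ⟨fun hx => ⟨hx.1, hx.2.1, hx.2.2.trans (Finset.sup_le fun y hy => ?_)⟩,
          fun hx => ⟨hx.1, hx.2.1, ?_⟩⟩
        · exact (Finset.mem_Icc.1 (Finset.mem_inter.1 hy).2).2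
        · exact Finset.le_sup (f := id) (Finset.mem_inter.2 ⟨hx.1, Finset.mem_Icc.2 hx.2⟩)
    rw [hU, Finset.card_union_of_disjoint, card_filter_exists_inter_Icc_eq (j := i - 1),
      gStarPrime, Finset.card_image_of_injOn, show k - (i - 1) = k - i + 1 by omega]
    · intro E hE E' hE' h
      rw [← Finset.insert_erase (memA hE).2.1, ← Finset.insert_erase (memA hE').2.1]
      exact congrArg (insert s) h
    · intro E' hE'
      obtain ⟨E, hE, rfl⟩ := Finset.mem_image.1 hE'
      obtain ⟨hEg, hsE, hEi⟩ := memA hE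
      exact ⟨(Finset.erase_subset _ _).trans (hAs E hEg), by
        rw [Finset.card_erase_of_mem hsE, hEi], by omega, hsn⟩
    · refine Finset.disjoint_right.2 fun A hA hA𝒜 => ?_
      obtain ⟨-, E', hE', hAE⟩ := Finset.mem_filter.1 hA
      obtain ⟨E, hE, rfl⟩ := Finset.mem_image.1 hE'
      obtain ⟨hEg, hsE, -⟩ := memA hE
      obtain ⟨G, hG, hGA⟩ := hgA.exists_subset hA𝒜
      have hGE : G ⊆ E.erase s := hAE ▸ Finset.subset_inter hGA (hAs G hG)
      have := hgAmin E hEg G hG (hGE.trans (Finset.erase_subset _ _))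
      exact Finset.notMem_erase s E (hGE (this ▸ hsE))
  · have hsub : DFam m l (gStar s (s + t - i) g𝓑) ⊆ ℬ := by
      intro B hB
      rw [hDB] at hB
      obtain ⟨hB, F, hF, rfl⟩ := Finset.mem_filter.1 hB
      exact hgB.mem_of_subset (memB hF).1 B hB Finset.inter_subset_left
    have hcard : (DFam m l (gStar s (s + t - i) g𝓑)).card
        = (gStar s (s + t - i) g𝓑).card * (m - s).choose (l + i - s - t) := by
      have his' : i ≤ s := by
        obtain ⟨E, hE⟩ := hne
        obtain ⟨hEg, -, rfl⟩ := memA hE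
        simpa using Finset.card_le_card (hAs E hEg)
      rw [hDB, card_filter_exists_inter_Icc_eq (j := s + t - i),
        show l - (s + t - i) = l + i - s - t by omega]
      intro F hF
      obtain ⟨hFg, hsF, hFc⟩ := memB hF
      exact ⟨hBs F hFg, hFc, hFc ▸ hgB.2.1 F hFg, (Finset.mem_Icc.1 (hgB.1 F hFg hsF)).2⟩
    rw [Finset.cast_card_sdiff hsub, hcard]
    push_cast
    ring
end

section
/- Let m, n, k, i, t be positive integers with t ≥ 3, t+2 ≤ i ≤ k, and min{m,n} ≥ (t+1)(k−t+1). Then h(m, n, k+i−t, k, k, i, t) > 0, i.e., (n−2k+t)·S(m, k+i−t, k, k) − (m−k−i+t+1)·T(n, k+i−t, i, k) > 0, as integers. -/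
/-- `S(n,s,i,j) = s(n−s+1) − i(j−i)`. -/
def Sfun (n s i j : ℤ) : ℤ := s * (n - s + 1) - i * (j - i)

/-- `T(n,s,i,j) = i(n−j−s+i+1) + (s−i)(j−i+1)`. -/
def Tfun (n s i j : ℤ) : ℤ := i * (n - j - s + i + 1) + (s - i) * (j - i + 1)

/-- For positive integers `m, n, k, i, t` with `t ≥ 3`, `t+2 ≤ i ≤ k` and
`min{m,n} ≥ (t+1)(k−t+1)`, one has `h(m,n,k+i−t,k,k,i,t) > 0`, i.e.
`(n−2k+t)·S(m,k+i−t,k,k) − (m−k−i+t+1)·T(n,k+i−t,i,k) > 0`. -/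
theorem statement11 (m n k i t : ℤ)
    (hm : 0 < m) (hn : 0 < n) (hk : 0 < k) (hi0 : 0 < i)
    (ht : 3 ≤ t) (hit : t + 2 ≤ i) (hik : i ≤ k)
    (hmin : (t + 1) * (k - t + 1) ≤ min m n) :
    0 < (n - 2 * k + t) * Sfun m (k + i - t) k k
        - (m - k - i + t + 1) * Tfun n (k + i - t) i k := by
  obtain ⟨c, hc⟩ := Int.le.dest ht
  obtain ⟨a, ha⟩ := Int.le.dest hit
  obtain ⟨b, hb⟩ := Int.le.dest hik
  obtain ⟨x, hx⟩ := Int.le.dest (hmin.trans (min_le_left m n))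
  obtain ⟨y, hy⟩ := Int.le.dest (hmin.trans (min_le_right m n))
  subst hc ha hb hx hy
  unfold Sfun Tfun
  ring_nf
  positivity
end

section
/- Let m, n, k, i, t be positive integers with t ≥ 3, t+2 ≤ i ≤ k, and min{m,n} ≥ (t+1)(k−t+1). Then H(m, n, k+i−t, k, k, i, t) > 0, i.e., (m+t−k−i)·S(n, k+i−t, i, k) − (n−k−i+t+1)·T(m, k+i−t, k, k) > 0, as integers. -/
/-- If `P + Q < a * D` and `D` is a positive lower bound for both `M` and `N`, then
`P / N + Q / M < a`, stated without denominators. -/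
theorem mul_add_mul_lt_mul_mul_of_add_lt {M N D P Q a : ℤ} (hD : 0 < D) (hDM : D ≤ M)
    (hDN : D ≤ N) (hP : 0 ≤ P) (hQ : 0 ≤ Q) (h : P + Q < a * D) :
    M * P + N * Q < M * N * a := by
  have hM : 0 < M := hD.trans_le hDM
  have hN : 0 < N := hD.trans_le hDN
  refine lt_of_mul_lt_mul_left (a := D) ?_ hD.le
  calc D * (M * P + N * Q) = D * (M * P) + D * (N * Q) := by ring
    _ ≤ N * (M * P) + M * (N * Q) := by gcongr
    _ = M * N * (P + Q) := by ring
    _ < M * N * (a * D) := by gcongr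
    _ = D * (M * N * a) := by ring

/-- For positive integers `m, n, k, i, t` with `t ≥ 3`, `t+2 ≤ i ≤ k` and
`min{m,n} ≥ (t+1)(k−t+1)`, one has `H(m,n,k+i−t,k,k,i,t) > 0`, i.e.
`(m+t−k−i)·S(n,k+i−t,i,k) − (n−k−i+t+1)·T(m,k+i−t,k,k) > 0`. -/
theorem statement12 (m n k i t : ℤ)
    (hm : 0 < m) (hn : 0 < n) (hk : 0 < k) (hi0 : 0 < i)
    (ht : 3 ≤ t) (hit : t + 2 ≤ i) (hik : i ≤ k)
    (hmin : (t + 1) * (k - t + 1) ≤ min m n) :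
    0 < (m + t - k - i) * Sfun n (k + i - t) i k
        - (n - k - i + t + 1) * Tfun m (k + i - t) k k := by
  obtain ⟨hm', hn'⟩ := le_min_iff.mp hmin
  obtain ⟨a, rfl⟩ : ∃ a, i = t + a := ⟨i - t, by ring⟩
  obtain ⟨b, rfl⟩ : ∃ b, k = t + a + b := ⟨k - (t + a), by ring⟩
  have ha : 2 ≤ a := by linarith
  have hb : 0 ≤ b := by linarith
  have hab : 2 ≤ (a - 1) * (t - 1) := by nlinarith
  have key := mul_add_mul_lt_mul_mul_of_add_lt
    (M := m - (t + 2 * a + b)) (N := n - (t + 2 * a + b) + 1)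
    (D := (t - 1) * a + t * b + 1) (P := (t + a) * b) (Q := t + 2 * a + b) (a := a)
    (by nlinarith) (by nlinarith) (by nlinarith) (by positivity) (by linarith)
    (by nlinarith [mul_nonneg hb (sub_nonneg.mpr hab)])
  unfold Sfun Tfun
  linarith
end

section
/- Let m, n, k, i, t be positive integers with t ≥ 3, t+2 ≤ i ≤ k, and min{m,n} ≥ (t+1)(k−t+1). Then h(m, n, 2i−t, k, k, i, t) > 0, i.e., (n−2i+t−k+i)·S(m, 2i−t, i, k) − (m−2i+t+1)·T(n, 2i−t, i, k) > 0, as integers. -/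
/-- For positive integers `m, n, k, i, t` with `t ≥ 3`, `t+2 ≤ i ≤ k` and
`min{m,n} ≥ (t+1)(k−t+1)`, one has `h(m,n,2i−t,k,k,i,t) > 0`, i.e.
`(n−2i+t−k+i)·S(m,2i−t,i,k) − (m−2i+t+1)·T(n,2i−t,i,k) > 0`. -/
theorem statement13 (m n k i t : ℤ)
    (hm : 0 < m) (hn : 0 < n) (hk : 0 < k) (hi0 : 0 < i)
    (ht : 3 ≤ t) (hit : t + 2 ≤ i) (hik : i ≤ k)
    (hmin : (t + 1) * (k - t + 1) ≤ min m n) :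
    0 < (n - 2 * i + t - k + i) * Sfun m (2 * i - t) i k
        - (m - 2 * i + t + 1) * Tfun n (2 * i - t) i k := by
  obtain ⟨hmN, hnN⟩ := le_min_iff.mp hmin
  obtain ⟨c, hc, rfl⟩ : ∃ c, 0 ≤ c ∧ t = c + 3 := ⟨t - 3, by linarith, by ring⟩
  obtain ⟨a, ha, rfl⟩ : ∃ a, 0 ≤ a ∧ i = a + c + 5 := ⟨i - c - 5, by linarith, by ring⟩
  obtain ⟨b, hb, rfl⟩ : ∃ b, 0 ≤ b ∧ k = a + c + 5 + b :=
    ⟨k - (a + c + 5), by linarith, by ring⟩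
  obtain ⟨p, hp, rfl⟩ : ∃ p, 0 ≤ p ∧ m = (c + 4) * (a + b + 3) + p :=
    ⟨m - (c + 4) * (a + b + 3), by linarith, by ring⟩
  obtain ⟨q, hq, rfl⟩ : ∃ q, 0 ≤ q ∧ n = (c + 4) * (a + b + 3) + q :=
    ⟨n - (c + 4) * (a + b + 3), by linarith, by ring⟩
  -- In the nonnegative variables `a, b, c, p, q` every coefficient is nonnegative.
  unfold Sfun Tfun
  ring_nf
  positivity
end

section
/- Let m, k, l, t be positive integers with 3 ≤ t < l ≤ k and m ≥ (t+1)(k−t+1). Then (2t+1)(l−t)(m−l) < t(m−t)(m−t−1). -/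
/-- For positive integers `m, k, l, t` with `3 ≤ t < l ≤ k` and
`m ≥ (t+1)(k−t+1)`, one has `(2t+1)(l−t)(m−l) < t(m−t)(m−t−1)`. -/
theorem statement15 (m k l t : ℤ)
    (hm : 0 < m) (hk : 0 < k) (hl : 0 < l) (ht : 3 ≤ t) (htl : t < l) (hlk : l ≤ k)
    (hmk : (t + 1) * (k - t + 1) ≤ m) :
    (2 * t + 1) * (l - t) * (m - l) < t * (m - t) * (m - t - 1) := by
  have ha : 0 < l - t := by linarith
  have hM : (t + 1) * (l - t) ≤ m - t - 1 := by nlinarith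
  have hMpos : 0 < m - t := by nlinarith
  calc (2 * t + 1) * (l - t) * (m - l)
      < (2 * t + 1) * (l - t) * (m - t) :=
        mul_lt_mul_of_pos_left (by linarith) (mul_pos (by linarith) ha)
    _ ≤ t * (t + 1) * (l - t) * (m - t) := by
        gcongr
        nlinarith
    _ = t * (m - t) * ((t + 1) * (l - t)) := by ring
    _ ≤ t * (m - t) * (m - t - 1) :=
        mul_le_mul_of_nonneg_left hM (mul_nonneg (by linarith) hMpos.le)
end

section
/- Let n, m, k, l, t be positive integers with 3 ≤ t < l ≤ k and min{m,n} ≥ (t+1)(k−t+1). Then (C(n−t, k−t) − C(n−t−2, k−t))·(C(m−t, l−t) + t·C(m−t−2, l−t−1)) < C(n−t, k−t)·C(m−t, l−t). -/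
theorem succ_mul_choose_pred_le_choose {t M b : ℕ} (h : (t + 1) * (b + 1) ≤ M + 2) :
    (t + 1) * M.choose b ≤ (M + 2).choose (b + 1) := by
  have h₁ := Nat.add_one_mul_choose_eq (M + 1) b
  have h₂ : M.choose b ≤ (M + 1).choose b := Nat.choose_le_choose b (Nat.le_succ M)
  refine Nat.le_of_mul_le_mul_right ?_ (Nat.succ_pos b)
  calc (t + 1) * M.choose b * (b + 1) = (t + 1) * (b + 1) * M.choose b := by ring
    _ ≤ (M + 2) * (M + 1).choose b := Nat.mul_le_mul h h₂
    _ = (M + 2).choose (b + 1) * (b + 1) := h₁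

theorem mul_choose_succ_le_succ_mul_choose {t N a : ℕ} (h : (t + 1) * a ≤ N + 1) :
    t * (N + 1).choose a ≤ (t + 1) * N.choose a := by
  have h₁ := Nat.choose_mul_succ_eq N a
  have h₂ : t * (N + 1) ≤ (t + 1) * (N + 1 - a) := by
    rw [Nat.mul_sub]
    refine Nat.le_sub_of_add_le ?_
    linarith
  refine Nat.le_of_mul_le_mul_right ?_ (Nat.succ_pos N)
  calc t * (N + 1).choose a * (N + 1) = (N + 1).choose a * (t * (N + 1)) := by ring
    _ ≤ (N + 1).choose a * ((t + 1) * (N + 1 - a)) := Nat.mul_le_mul_left _ h₂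
    _ = (t + 1) * ((N + 1).choose a * (N + 1 - a)) := by ring
    _ = (t + 1) * N.choose a * (N + 1) := by rw [← h₁]; ring

theorem sub_mul_add_lt_mul {t A B P Q : ℕ} (ht : 2 ≤ t) (hA : 0 < A) (hB : 0 < B)
    (hQ : (t + 1) * Q ≤ B) (hP : t ^ 2 * A ≤ (t + 1) ^ 2 * P) :
    (A - P) * (B + t * Q) < A * B := by
  have h₁ : (t + 1) ^ 2 * (A - P) ≤ (2 * t + 1) * A := by
    rw [Nat.mul_sub]
    refine Nat.sub_le_of_le_add ?_
    linarith
  have h₂ : (t + 1) * (B + t * Q) ≤ (2 * t + 1) * B := by nlinarith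
  have h₃ : (2 * t + 1) ^ 2 < (t + 1) ^ 3 := by nlinarith
  refine Nat.lt_of_mul_lt_mul_left (a := (t + 1) ^ 3) ?_
  calc (t + 1) ^ 3 * ((A - P) * (B + t * Q))
      = (t + 1) ^ 2 * (A - P) * ((t + 1) * (B + t * Q)) := by ring
    _ ≤ (2 * t + 1) * A * ((2 * t + 1) * B) := Nat.mul_le_mul h₁ h₂
    _ = (2 * t + 1) ^ 2 * (A * B) := by ring
    _ < (t + 1) ^ 3 * (A * B) := Nat.mul_lt_mul_of_pos_right h₃ (Nat.mul_pos hA hB)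

/-- For positive integers `n, m, k, l, t` with `3 ≤ t < l ≤ k` and
`min{m,n} ≥ (t+1)(k−t+1)`,
`(C(n−t,k−t) − C(n−t−2,k−t))·(C(m−t,l−t) + t·C(m−t−2,l−t−1)) < C(n−t,k−t)·C(m−t,l−t)`. -/
theorem statement16 (n m k l t : ℕ)
    (ht : 3 ≤ t) (htl : t < l) (hlk : l ≤ k)
    (hmin : (t + 1) * (k - t + 1) ≤ min m n) :
    ((n - t).choose (k - t) - (n - t - 2).choose (k - t))
        * ((m - t).choose (l - t) + t * (m - t - 2).choose (l - t - 1))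
      < (n - t).choose (k - t) * (m - t).choose (l - t) := by
  obtain ⟨b, rfl⟩ : ∃ b, l = t + (b + 1) := ⟨l - t - 1, by omega⟩
  obtain ⟨c, rfl⟩ : ∃ c, k = t + (b + 1) + c := ⟨k - (t + (b + 1)), by omega⟩
  have hk : t + (b + 1) + c - t = b + 1 + c := by omega
  have hl : t + (b + 1) - t = b + 1 := by omega
  rw [hk] at hmin
  have hm : (t + 1) * (b + 1 + c + 1) ≤ m := hmin.trans (min_le_left _ _)
  have hn : (t + 1) * (b + 1 + c + 1) ≤ n := hmin.trans (min_le_right _ _)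
  have hexp : (t + 1) * (b + 1 + c + 1) = (t + 1) * (b + 1 + c) + (t + 1) := by ring
  have hpos : b + 1 + c ≤ (t + 1) * (b + 1 + c) := Nat.le_mul_of_pos_left _ (Nat.succ_pos t)
  have hle : (t + 1) * (b + 1) ≤ (t + 1) * (b + 1 + c) :=
    Nat.mul_le_mul_left _ (Nat.le_add_right _ _)
  have hbig : 4 ≤ (t + 1) * (b + 1) := by nlinarith
  obtain ⟨N, rfl⟩ : ∃ N, n = t + (N + 2) := ⟨n - t - 2, by omega⟩
  obtain ⟨M, rfl⟩ : ∃ M, m = t + (M + 2) := ⟨m - t - 2, by omega⟩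
  rw [hk, hl, Nat.add_sub_cancel_left, Nat.add_sub_cancel_left, Nat.add_sub_cancel,
    Nat.add_sub_cancel, Nat.add_sub_cancel]
  refine sub_mul_add_lt_mul (by omega) (Nat.choose_pos (by omega)) (Nat.choose_pos (by omega))
    (succ_mul_choose_pred_le_choose (by omega)) ?_
  have h₁ : t * (N + 2).choose (b + 1 + c) ≤ (t + 1) * (N + 1).choose (b + 1 + c) :=
    mul_choose_succ_le_succ_mul_choose (by omega)
  have h₂ : t * (N + 1).choose (b + 1 + c) ≤ (t + 1) * N.choose (b + 1 + c) :=
    mul_choose_succ_le_succ_mul_choose (by omega)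
  calc t ^ 2 * (N + 2).choose (b + 1 + c) = t * (t * (N + 2).choose (b + 1 + c)) := by ring
    _ ≤ t * ((t + 1) * (N + 1).choose (b + 1 + c)) := Nat.mul_le_mul_left _ h₁
    _ = (t + 1) * (t * (N + 1).choose (b + 1 + c)) := by ring
    _ ≤ (t + 1) * ((t + 1) * N.choose (b + 1 + c)) := Nat.mul_le_mul_left _ h₂
    _ = (t + 1) ^ 2 * N.choose (b + 1 + c) := by ring
end

section
/- Let n, m, k, l, t be positive integers with 3 ≤ t < l ≤ k and min{m,n} ≥ (t+1)(k−t+1). Then (C(n−t, k−t) + t·C(n−t−2, k−t−1))·(C(m−t, l−t) − C(m−t−2, l−t)) < C(n−t, k−t)·C(m−t, l−t). -/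
theorem Nat.mul_choose_pred_le_choose {N a s : ℕ} (ha : 0 < a) (h : s * a ≤ N) (hN : 0 < N) :
    s * (N - 1).choose (a - 1) ≤ N.choose a := by
  obtain ⟨a, rfl⟩ := Nat.exists_eq_succ_of_ne_zero ha.ne'
  obtain ⟨N, rfl⟩ := Nat.exists_eq_succ_of_ne_zero hN.ne'
  simp only [Nat.succ_eq_add_one, Nat.add_sub_cancel] at *
  refine Nat.le_of_mul_le_mul_right ?_ (Nat.succ_pos a)
  calc s * N.choose a * (a + 1) = s * (a + 1) * N.choose a := by ring
    _ ≤ (N + 1) * N.choose a := by gcongr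
    _ = (N + 1).choose (a + 1) * (a + 1) := Nat.add_one_mul_choose_eq N a

theorem Nat.mul_choose_le_succ_mul_choose_pred {M b t : ℕ} (h : (t + 1) * b ≤ M + 1) :
    t * (M + 1).choose b ≤ (t + 1) * M.choose b := by
  refine Nat.le_of_mul_le_mul_right ?_ (Nat.succ_pos M)
  have key := Nat.choose_mul_succ_eq M b
  have hle : t * (M + 1) ≤ (t + 1) * (M + 1 - b) := by
    rw [Nat.mul_sub]
    apply Nat.le_sub_of_add_le
    linarith
  calc t * (M + 1).choose b * (M + 1) = t * (M + 1) * (M + 1).choose b := by ring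
    _ ≤ (t + 1) * (M + 1 - b) * (M + 1).choose b := by gcongr
    _ = (t + 1) * M.choose b * (M + 1) := by rw [mul_assoc (t + 1), mul_assoc, key]; ring

/-- For positive integers `n, m, k, l, t` with `3 ≤ t < l ≤ k` and
`min{m,n} ≥ (t+1)(k−t+1)`,
`(C(n−t,k−t) + t·C(n−t−2,k−t−1))·(C(m−t,l−t) − C(m−t−2,l−t)) < C(n−t,k−t)·C(m−t,l−t)`. -/
theorem statement17 (n m k l t : ℕ)
    (ht : 3 ≤ t) (htl : t < l) (hlk : l ≤ k)
    (hmin : (t + 1) * (k - t + 1) ≤ min m n) :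
    ((n - t).choose (k - t) + t * (n - t - 2).choose (k - t - 1))
        * ((m - t).choose (l - t) - (m - t - 2).choose (l - t))
      < (n - t).choose (k - t) * (m - t).choose (l - t) := by
  obtain ⟨hm, hn⟩ := le_min_iff.mp hmin
  have ha : 0 < k - t := by omega
  have hba : l - t ≤ k - t := by omega
  have hb : 0 < l - t := by omega
  generalize k - t = a at *
  generalize l - t = b at *
  have hab : (t + 1) * b ≤ (t + 1) * a := by gcongr
  have hta : t + 1 ≤ (t + 1) * a := Nat.le_mul_of_pos_right _ ha
  rw [mul_add, mul_one] at hm hn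
  obtain ⟨M, hM⟩ : ∃ M, m - t = M + 2 := ⟨m - t - 2, by omega⟩
  have hN : (t + 1) * a ≤ n - t := by omega
  have hA : (t + 1) * (n - t - 2).choose (a - 1) ≤ (n - t).choose a :=
    (Nat.mul_le_mul_left _ (Nat.choose_le_choose _ (by omega))).trans
      (Nat.mul_choose_pred_le_choose ha hN (by omega))
  have hA0 : 0 < (n - t).choose a := Nat.choose_pos (by nlinarith)
  have hB1 := Nat.mul_choose_le_succ_mul_choose_pred (M := M) (b := b) (t := t) (by omega)
  have hB2 := Nat.mul_choose_le_succ_mul_choose_pred (M := M + 1) (b := b) (t := t) (by omega)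
  have hB0 : 0 < (M + 2).choose b :=
    Nat.choose_pos ((Nat.le_mul_of_pos_left b (Nat.add_one_pos t)).trans (by omega))
  have hBle : M.choose b ≤ (M + 2).choose b := Nat.choose_le_choose _ (by omega)
  rw [hM, Nat.add_sub_cancel]
  generalize (n - t).choose a = A at *
  generalize (n - t - 2).choose (a - 1) = A' at *
  have hB : t ^ 2 * (M + 2).choose b ≤ (t + 1) ^ 2 * M.choose b := by
    nlinarith [Nat.mul_le_mul_left t hB2, Nat.mul_le_mul_left (t + 1) hB1]
  generalize (M + 2).choose b = B at *
  generalize M.choose b = B' at *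
  obtain ⟨D, rfl⟩ := Nat.exists_eq_add_of_le hBle
  rw [Nat.add_sub_cancel_left]
  have hX : (t + 1) * (A + t * A') ≤ (2 * t + 1) * A := by
    nlinarith [Nat.mul_le_mul_left t hA]
  have hY : (t + 1) ^ 2 * D ≤ (2 * t + 1) * (B' + D) := by nlinarith
  have ht3 : (2 * t + 1) ^ 2 < (t + 1) ^ 3 := by nlinarith [mul_le_mul ht ht (by omega) (by omega)]
  refine Nat.lt_of_mul_lt_mul_left (a := (t + 1) ^ 3) ?_
  calc (t + 1) ^ 3 * ((A + t * A') * D)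
      = ((t + 1) * (A + t * A')) * ((t + 1) ^ 2 * D) := by ring
    _ ≤ ((2 * t + 1) * A) * ((2 * t + 1) * (B' + D)) := Nat.mul_le_mul hX hY
    _ = (2 * t + 1) ^ 2 * (A * (B' + D)) := by ring
    _ < (t + 1) ^ 3 * (A * (B' + D)) := Nat.mul_lt_mul_of_pos_right ht3 (Nat.mul_pos hA0 hB0)
end
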